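/- arXiv:2311.08088 — 6 statements merged into one kernel-verified Lean document; each statement's English description precedes it below -/
import Mathlib

section
/- Let A ∈ ℝ^{n×n}, B ∈ ℝ^{n×r}, G ∈ ℝ^{n×m}, C ∈ ℝ^{p×n}, let Q ∈ ℝ^{p×p} be symmetric with Q ≺ 0, S ∈ ℝ^{p×m}, and R ∈ ℝ^{m×m} symmetric. Then the following are equivalent: (i) there exist K ∈ ℝ^{r×n} and a symmetric 𝒫 ∈ ℝ^{n×n} with 𝒫 ≻ 0 such that the closed-loop dissipation LMI holds: the 2×2 block matrix [[(A+BK)ᵀ𝒫(A+BK) − 𝒫 − CᵀQC, (A+BK)ᵀ𝒫G − CᵀS], [Gᵀ𝒫(A+BK) − SᵀC, Gᵀ𝒫G − R]] ⪯ 0; (ii) there exist a symmetric P ∈ ℝ^{n×n} with P ≻ 0 and Z ∈ ℝ^{r×n} such that the 4×4 block matrix [[P, AP+BZ, G, 0], [(AP+BZ)ᵀ, P, PCᵀS, PCᵀ], [Gᵀ, SᵀCP, R, 0], [0, CP, 0, −Q⁻¹]] ⪰ 0. Moreover, when (ii) holds, (i) holds with 𝒫 = P⁻¹ and K = ZP⁻¹,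 and when (i) holds, (ii) holds with P = 𝒫⁻¹ and Z = K𝒫⁻¹. -/
open Matrix

/-- The closed-loop dissipation LMI:
`[[(A+BK)ᵀ𝒫(A+BK) − 𝒫 − CᵀQC, (A+BK)ᵀ𝒫G − CᵀS], [Gᵀ𝒫(A+BK) − SᵀC, Gᵀ𝒫G − R]] ⪯ 0`. -/
def closedLoopDissipLMI {n r m p : ℕ}
    (A : Matrix (Fin n) (Fin n) ℝ) (B : Matrix (Fin n) (Fin r) ℝ)
    (G : Matrix (Fin n) (Fin m) ℝ) (C : Matrix (Fin p) (Fin n) ℝ)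
    (Q : Matrix (Fin p) (Fin p) ℝ) (S : Matrix (Fin p) (Fin m) ℝ)
    (R : Matrix (Fin m) (Fin m) ℝ)
    (K : Matrix (Fin r) (Fin n) ℝ) (P0 : Matrix (Fin n) (Fin n) ℝ) : Prop :=
  (-(Matrix.fromBlocks
      ((A + B * K)ᵀ * P0 * (A + B * K) - P0 - Cᵀ * Q * C)
      ((A + B * K)ᵀ * P0 * G - Cᵀ * S)
      (Gᵀ * P0 * (A + B * K) - Sᵀ * C)
      (Gᵀ * P0 * G - R))).PosSemidef

/-- The primal 4×4 block LMI:
`[[P, AP+BZ, G, 0], [(AP+BZ)ᵀ, P, PCᵀS, PCᵀ], [Gᵀ, SᵀCP, R, 0], [0, CP, 0, −Q⁻¹]] ⪰ 0`. -/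
def primalControlLMI {n r m p : ℕ}
    (A : Matrix (Fin n) (Fin n) ℝ) (B : Matrix (Fin n) (Fin r) ℝ)
    (G : Matrix (Fin n) (Fin m) ℝ) (C : Matrix (Fin p) (Fin n) ℝ)
    (Q : Matrix (Fin p) (Fin p) ℝ) (S : Matrix (Fin p) (Fin m) ℝ)
    (R : Matrix (Fin m) (Fin m) ℝ)
    (P : Matrix (Fin n) (Fin n) ℝ) (Z : Matrix (Fin r) (Fin n) ℝ) : Prop :=
  (Matrix.fromBlocks
    (Matrix.fromBlocks P (A * P + B * Z) (A * P + B * Z)ᵀ P)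
    (Matrix.fromBlocks G 0 (P * Cᵀ * S) (P * Cᵀ))
    (Matrix.fromBlocks Gᵀ (Sᵀ * C * P) 0 (C * P))
    (Matrix.fromBlocks R 0 0 (-(Q⁻¹)))).PosSemidef

/-- Regroups a fourfold sum by pairing the outer and the inner summands. -/
def sumOuterInnerEquiv (α β γ δ : Type*) : (α ⊕ δ) ⊕ (β ⊕ γ) ≃ (α ⊕ β) ⊕ (γ ⊕ δ) where
  toFun := Sum.elim (Sum.elim (Sum.inl ∘ Sum.inl) (Sum.inr ∘ Sum.inr))
    (Sum.elim (Sum.inl ∘ Sum.inr) (Sum.inr ∘ Sum.inl))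
  invFun := Sum.elim (Sum.elim (Sum.inl ∘ Sum.inl) (Sum.inr ∘ Sum.inl))
    (Sum.elim (Sum.inr ∘ Sum.inr) (Sum.inl ∘ Sum.inr))
  left_inv := by rintro ((_ | _) | (_ | _)) <;> rfl
  right_inv := by rintro ((_ | _) | (_ | _)) <;> rfl

/-- Schur complement in a block matrix whose first and last diagonal blocks are positive definite
and not coupled to each other. -/
theorem posSemidef_fromBlocks_outer_iff {α β γ δ : Type*} [Fintype α] [Fintype β] [Fintype γ]
    [Fintype δ] [DecidableEq α] [DecidableEq δ]
    {X : Matrix α α ℝ} {Y : Matrix δ δ ℝ} (hX : X.PosDef) (hY : Y.PosDef)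
    (E : Matrix α β ℝ) (F : Matrix α γ ℝ) (H : Matrix δ β ℝ)
    (U : Matrix β β ℝ) (V : Matrix β γ ℝ) (W : Matrix γ γ ℝ) :
    (fromBlocks (fromBlocks X E Eᵀ U) (fromBlocks F 0 V Hᵀ)
      (fromBlocks Fᵀ Vᵀ 0 H) (fromBlocks W 0 0 Y)).PosSemidef ↔
    (fromBlocks (U - Eᵀ * X⁻¹ * E - Hᵀ * Y⁻¹ * H) (V - Eᵀ * X⁻¹ * F)
      (Vᵀ - Fᵀ * X⁻¹ * E) (W - Fᵀ * X⁻¹ * F)).PosSemidef := by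
  have hD : (fromBlocks X 0 0 Y).PosDef := by
    refine .of_dotProduct_mulVec_pos
      (hX.isHermitian.fromBlocks (by simp) hY.isHermitian) fun x hx => ?_
    rw [← Sum.elim_comp_inl_inr x] at hx ⊢
    set u := x ∘ Sum.inl
    set v := x ∘ Sum.inr
    have hu := hX.posSemidef.dotProduct_mulVec_nonneg u
    have hv := hY.posSemidef.dotProduct_mulVec_nonneg v
    have hsum : star (Sum.elim u v) ⬝ᵥ (fromBlocks X 0 0 Y *ᵥ Sum.elim u v) =
        star u ⬝ᵥ (X *ᵥ u) + star v ⬝ᵥ (Y *ᵥ v) := by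
      simp [fromBlocks_mulVec]
    rw [hsum]
    by_cases h : u = 0
    · have hv0 : v ≠ 0 := by
        intro h'
        exact hx (by simp [h, h'])
      exact add_pos_of_nonneg_of_pos hu (hY.dotProduct_mulVec_pos hv0)
    · exact add_pos_of_pos_of_nonneg (hX.dotProduct_mulVec_pos h) hv
  have hXu : IsUnit X := hX.isUnit
  have hYu : IsUnit Y := hY.isUnit
  let := hD.isUnit.invertible
  have hinv : (fromBlocks X 0 0 Y)⁻¹ = fromBlocks X⁻¹ 0 0 Y⁻¹ := by
    apply inv_eq_left_inv
    simp [fromBlocks_multiply, nonsing_inv_mul _ ((isUnit_iff_isUnit_det _).1 hXu),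
      nonsing_inv_mul _ ((isUnit_iff_isUnit_det _).1 hYu)]
  rw [← posSemidef_submatrix_equiv (sumOuterInnerEquiv α β γ δ)]
  have hre : (fromBlocks (fromBlocks X E Eᵀ U) (fromBlocks F 0 V Hᵀ)
      (fromBlocks Fᵀ Vᵀ 0 H) (fromBlocks W 0 0 Y)).submatrix (sumOuterInnerEquiv α β γ δ)
        (sumOuterInnerEquiv α β γ δ) =
      fromBlocks (fromBlocks X 0 0 Y) (fromBlocks E F H 0) (fromBlocks E F H 0)ᴴ
        (fromBlocks U V Vᵀ W) := by
    ext ((_ | _) | (_ | _)) ((_ | _) | (_ | _)) <;> simp [sumOuterInnerEquiv]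
  rw [hre, PosDef.fromBlocks₁₁ _ _ hD, hinv]
  simp [fromBlocks_multiply, fromBlocks_transpose, sub_eq_add_neg, fromBlocks_neg, fromBlocks_add,
    add_comm, add_assoc]

theorem closedLoopDissipLMI_iff_primalControlLMI {n r m p : ℕ}
    (A : Matrix (Fin n) (Fin n) ℝ) (B : Matrix (Fin n) (Fin r) ℝ)
    (G : Matrix (Fin n) (Fin m) ℝ) (C : Matrix (Fin p) (Fin n) ℝ)
    {Q : Matrix (Fin p) (Fin p) ℝ} (S : Matrix (Fin p) (Fin m) ℝ)
    (R : Matrix (Fin m) (Fin m) ℝ) (hQ : (-Q).PosDef)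
    (Z : Matrix (Fin r) (Fin n) ℝ) {P : Matrix (Fin n) (Fin n) ℝ} (hP : P.PosDef) :
    closedLoopDissipLMI A B G C Q S R (Z * P⁻¹) P⁻¹ ↔ primalControlLMI A B G C Q S R P Z := by
  have hPt : Pᵀ = P := hP.isHermitian
  have hPd : IsUnit P.det := (isUnit_iff_isUnit_det _).1 hP.isUnit
  have hQinv : -(Q⁻¹) = (-Q)⁻¹ := by
    have hQd : IsUnit Q.det := (isUnit_iff_isUnit_det _).1 (by simpa using hQ.isUnit.neg)
    refine (inv_eq_left_inv ?_).symm
    simp [nonsing_inv_mul _ hQd]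
  have hacl : A + B * (Z * P⁻¹) = (A * P + B * Z) * P⁻¹ := by
    simp [Matrix.add_mul, Matrix.mul_assoc, mul_nonsing_inv _ hPd]
  have hprimal := posSemidef_fromBlocks_outer_iff hP hQ.inv (A * P + B * Z) G (C * P) P
    (P * Cᵀ * S) R
  have hQi : ((-Q)⁻¹)⁻¹ = -Q :=
    nonsing_inv_nonsing_inv _ ((isUnit_iff_isUnit_det _).1 hQ.isUnit)
  simp only [transpose_mul, transpose_transpose, hPt, hQi] at hprimal
  unfold closedLoopDissipLMI primalControlLMI
  rw [hacl, hQinv]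
  generalize A * P + B * Z = M at *
  rw [← Matrix.mul_assoc] at hprimal
  rw [hprimal]
  have hT : IsUnit (fromBlocks P 0 0 (1 : Matrix (Fin m) (Fin m) ℝ)) := by
    rw [isUnit_iff_isUnit_det]
    simpa using hPd
  rw [← hT.posSemidef_star_left_conjugate_iff]
  have hPit : (P⁻¹)ᵀ = P⁻¹ := by rw [transpose_nonsing_inv, hPt]
  have hcancel {k : ℕ} (N : Matrix (Fin n) (Fin k) ℝ) : P * (P⁻¹ * N) = N :=
    mul_nonsing_inv_cancel_left P N hPd
  refine iff_of_eq (congrArg _ ?_)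
  simp [star_eq_conjTranspose, fromBlocks_transpose, fromBlocks_multiply, fromBlocks_neg,
    hPt, hPit, Matrix.mul_sub, Matrix.sub_mul, Matrix.mul_assoc, hcancel,
    nonsing_inv_mul _ hPd]
  abel

/-- Primal dissipative control: the closed-loop system is (Q,S,R)-dissipative with a
quadratic storage function (for some feedback gain) if and only if the primal LMI
is feasible; moreover the solutions are related by `𝒫 = P⁻¹`, `K = ZP⁻¹` and conversely. -/
theorem dissipative_control_primal {n r m p : ℕ}
    (A : Matrix (Fin n) (Fin n) ℝ) (B : Matrix (Fin n) (Fin r) ℝ)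
    (G : Matrix (Fin n) (Fin m) ℝ) (C : Matrix (Fin p) (Fin n) ℝ)
    (Q : Matrix (Fin p) (Fin p) ℝ) (S : Matrix (Fin p) (Fin m) ℝ)
    (R : Matrix (Fin m) (Fin m) ℝ)
    (hQsymm : Q.IsSymm) (hQneg : (-Q).PosDef) (hRsymm : R.IsSymm) :
    ((∃ (K : Matrix (Fin r) (Fin n) ℝ) (P0 : Matrix (Fin n) (Fin n) ℝ),
        P0.PosDef ∧ closedLoopDissipLMI A B G C Q S R K P0) ↔
      (∃ (P : Matrix (Fin n) (Fin n) ℝ) (Z : Matrix (Fin r) (Fin n) ℝ),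
        P.PosDef ∧ primalControlLMI A B G C Q S R P Z)) ∧
    (∀ (P : Matrix (Fin n) (Fin n) ℝ) (Z : Matrix (Fin r) (Fin n) ℝ),
      P.PosDef → primalControlLMI A B G C Q S R P Z →
        (P⁻¹).PosDef ∧ closedLoopDissipLMI A B G C Q S R (Z * P⁻¹) P⁻¹) ∧
    (∀ (K : Matrix (Fin r) (Fin n) ℝ) (P0 : Matrix (Fin n) (Fin n) ℝ),
      P0.PosDef → closedLoopDissipLMI A B G C Q S R K P0 →
        (P0⁻¹).PosDef ∧ primalControlLMI A B G C Q S R P0⁻¹ (K * P0⁻¹)) := by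
  have hinv {P : Matrix (Fin n) (Fin n) ℝ} (hP : P.PosDef) : P⁻¹⁻¹ = P :=
    nonsing_inv_nonsing_inv P ((isUnit_iff_isUnit_det _).1 hP.isUnit)
  have hto (P : Matrix (Fin n) (Fin n) ℝ) (Z : Matrix (Fin r) (Fin n) ℝ) (hP : P.PosDef)
      (h : primalControlLMI A B G C Q S R P Z) :
      (P⁻¹).PosDef ∧ closedLoopDissipLMI A B G C Q S R (Z * P⁻¹) P⁻¹ :=
    ⟨hP.inv, (closedLoopDissipLMI_iff_primalControlLMI A B G C S R hQneg Z hP).2 h⟩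
  have hfrom (K : Matrix (Fin r) (Fin n) ℝ) (P0 : Matrix (Fin n) (Fin n) ℝ) (hP0 : P0.PosDef)
      (h : closedLoopDissipLMI A B G C Q S R K P0) :
      (P0⁻¹).PosDef ∧ primalControlLMI A B G C Q S R P0⁻¹ (K * P0⁻¹) := by
    refine ⟨hP0.inv,
      (closedLoopDissipLMI_iff_primalControlLMI A B G C S R hQneg (K * P0⁻¹) hP0.inv).1 ?_⟩
    rwa [hinv hP0, nonsing_inv_mul_cancel_right _ _ ((isUnit_iff_isUnit_det _).1 hP0.isUnit)]
  exact ⟨⟨fun ⟨K, P0, hP0, h⟩ => ⟨_, _, hfrom K P0 hP0 h⟩,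
    fun ⟨P, Z, hP, h⟩ => ⟨_, _, hto P Z hP h⟩⟩, hto, hfrom⟩
end

section
/- For i = 1,…,N let A_i ∈ ℝ^{n×n}, B_i ∈ ℝ^{n×p}, C_i ∈ ℝ^{p×n}, and assume each pair (A_i, C_i) is detectable, i.e., every sequence (ξ_k) in ℝⁿ with ξ_{k+1} = A_i ξ_k and C_i ξ_k = 0 for all k satisfies ξ_k → 0. Suppose there are symmetric matrices P_i ≻ 0, Q̂_i, R̂_i ∈ ℝ^{p×p} such that for all x ∈ ℝⁿ and u ∈ ℝᵖ: (A_i x + B_i u)ᵀP_i(A_i x + B_i u) − xᵀP_i x ≤ (C_i x + R̂_i u)ᵀu − (C_i x)ᵀQ̂_i(C_i x) (output strict passivity with respect to the virtual output z_i = y_i + R̂_i u_i, with quadratic positive definite storage V_i(x) = xᵀP_i x). Let ℒ be the weighted Laplacian of a connected undirected graph on N nodes, L = ℒ ⊗ I_p, Q̂ = diag(Q̂₁,…,Q̂_N), R̂ = diag(R̂₁,…,R̂_N). If L − LᵀR̂L + Q̂ ≻ 0, then the interconnected network x⁺ = (A − BLC)x, where A = diag(A₁,…,A_N), B = diag(B₁,…,B_N),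 C = diag(C₁,…,C_N), is asymptotically stable: every trajectory x_{k+1} = (A − BLC)x_k converges to 0. -/
open Matrix Kronecker Filter

/-- Block-diagonal matrix built from `N` blocks of size `a × b`. -/
def blkDiag {N a b : ℕ} (M : Fin N → Matrix (Fin a) (Fin b) ℝ) :
    Matrix (Fin N × Fin a) (Fin N × Fin b) ℝ :=
  Matrix.of fun x y => if x.1 = y.1 then M x.1 x.2 y.2 else 0

open Function Topology in
/-- LaSalle's invariance principle in discrete time, for a Lyapunov function with quadratic
growth. -/
theorem tendsto_zero_of_lyapunov {E : Type*} [NormedAddCommGroup E] [ProperSpace E]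
    {F : E → E} {V : E → ℝ} (hF : Continuous F) (hV : Continuous V) (hV0 : V 0 = 0)
    {c : ℝ} (hc : 0 < c) (hVc : ∀ x, c * ‖x‖ ^ 2 ≤ V x) (hdec : ∀ x, V (F x) ≤ V x)
    (hinv : ∀ z, (∀ k, V (F^[k] z) = V z) → Tendsto (fun k => F^[k] z) atTop (𝓝 0))
    {x : ℕ → E} (hx : ∀ k, x (k + 1) = F (x k)) : Tendsto x atTop (𝓝 0) := by
  have hanti : Antitone fun k => V (x k) :=
    antitone_nat_of_succ_le fun k => by rw [hx]; exact hdec _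
  have hnonneg : ∀ y, 0 ≤ V y := fun y => le_trans (by positivity) (hVc y)
  obtain ⟨l, hl⟩ : ∃ l, Tendsto (fun k => V (x k)) atTop (𝓝 l) :=
    ⟨_, tendsto_atTop_ciInf hanti ⟨0, by rintro _ ⟨k, rfl⟩; exact hnonneg _⟩⟩
  have hbdd : ∀ k, x k ∈ Metric.closedBall (0 : E) √(V (x 0) / c) := fun k => by
    rw [mem_closedBall_zero_iff]
    refine Real.le_sqrt_of_sq_le ?_
    rw [le_div_iff₀ hc, mul_comm]
    exact (hVc _).trans (hanti (Nat.zero_le k))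
  obtain ⟨z, -, φ, hφ, hz⟩ := (isCompact_closedBall (0 : E) _).tendsto_subseq hbdd
  have hiter : ∀ j k, x (k + j) = F^[j] (x k) := fun j k => by
    induction j with
    | zero => rfl
    | succ j ih => rw [iterate_succ_apply', ← ih, ← hx, Nat.add_assoc]
  have hVz : ∀ j, V (F^[j] z) = l := fun j => by
    have h1 : Tendsto (fun k => V (F^[j] (x (φ k)))) atTop (𝓝 (V (F^[j] z))) :=
      ((hV.comp (hF.iterate j)).tendsto z).comp hz
    refine tendsto_nhds_unique h1 ?_
    simp only [← hiter]
    exact hl.comp (tendsto_atTop_mono (fun k => Nat.le_add_right _ j) hφ.tendsto_atTop)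
  have hl0 : l = 0 := by
    have h1 := (hV.tendsto 0).comp (hinv z fun k => (hVz k).trans (hVz 0).symm)
    simp only [comp_def, hVz, hV0] at h1
    exact tendsto_nhds_unique tendsto_const_nhds h1
  subst hl0
  have h2 : Tendsto (fun k => √(V (x k) / c)) atTop (𝓝 0) := by
    simpa using (hl.div_const c).sqrt
  refine squeeze_zero_norm (fun k => Real.le_sqrt_of_sq_le ?_) h2
  rw [le_div_iff₀ hc, mul_comm]
  exact hVc _

theorem exists_pos_mul_norm_sq_le {E : Type*} [NormedAddCommGroup E] [NormedSpace ℝ E]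
    [ProperSpace E] {V : E → ℝ} (hV : Continuous V) (hpos : ∀ x, x ≠ 0 → 0 < V x)
    (hhom : ∀ (t : ℝ) x, V (t • x) = t ^ 2 * V x) :
    ∃ c > 0, ∀ x, c * ‖x‖ ^ 2 ≤ V x := by
  have hV0 : V 0 = 0 := by simpa using hhom 0 0
  have hscale : ∀ x : E, x ≠ 0 →
      ‖x‖⁻¹ • x ∈ Metric.sphere (0 : E) 1 ∧ V x = V (‖x‖⁻¹ • x) * ‖x‖ ^ 2 := fun x hx => by
    have := norm_ne_zero_iff.2 hx
    refine ⟨by simp [norm_smul, this], ?_⟩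
    rw [hhom]
    field_simp
  rcases (Metric.sphere (0 : E) 1).eq_empty_or_nonempty with h | h
  · refine ⟨1, one_pos, fun x => ?_⟩
    by_cases hx : x = 0
    · simp [hx, hV0]
    · exact absurd (hscale x hx).1 (by simp [h])
  · obtain ⟨y, hy, hmin⟩ := (isCompact_sphere (0 : E) 1).exists_isMinOn h hV.continuousOn
    refine ⟨V y, hpos y (by rintro rfl; simp at hy), fun x => ?_⟩
    by_cases hx : x = 0
    · simp [hx, hV0]
    · obtain ⟨h1, h2⟩ := hscale x hx
      rw [h2]
      exact mul_le_mul_of_nonneg_right (hmin h1) (by positivity)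

theorem curry_blkDiag_mulVec {N a b : ℕ} (M : Fin N → Matrix (Fin a) (Fin b) ℝ)
    (v : Fin N × Fin b → ℝ) (i : Fin N) :
    Function.curry (blkDiag M *ᵥ v) i = M i *ᵥ Function.curry v i := by
  ext r
  simp [blkDiag, Function.curry, mulVec, dotProduct, Fintype.sum_prod_type]

theorem sum_curry_dotProduct_curry {N a : ℕ} (v w : Fin N × Fin a → ℝ) :
    ∑ i, Function.curry v i ⬝ᵥ Function.curry w i = v ⬝ᵥ w := by
  simp [dotProduct, Fintype.sum_prod_type, Function.curry]

theorem dotProduct_blkDiag_mulVec_pos {N a : ℕ} {M : Fin N → Matrix (Fin a) (Fin a) ℝ}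
    (hM : ∀ i, (M i).PosDef) {v : Fin N × Fin a → ℝ} (hv : v ≠ 0) :
    0 < v ⬝ᵥ (blkDiag M *ᵥ v) := by
  rw [← sum_curry_dotProduct_curry]
  simp only [curry_blkDiag_mulVec]
  obtain ⟨⟨i, r⟩, hir⟩ := Function.ne_iff.1 hv
  refine Finset.sum_pos' (fun j _ => by simpa using (hM j).posSemidef.dotProduct_mulVec_nonneg _)
    ⟨i, Finset.mem_univ i, ?_⟩
  have h : Function.curry v i ≠ 0 := fun h => hir (congrFun h r)
  simpa using (hM i).dotProduct_mulVec_pos h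

/-- Dissipation inequality of the network obtained from interconnecting output strictly passive
subsystems through `u = -L y`. -/
theorem network_dissipation {N n p : ℕ}
    {A : Fin N → Matrix (Fin n) (Fin n) ℝ} {B : Fin N → Matrix (Fin n) (Fin p) ℝ}
    {C : Fin N → Matrix (Fin p) (Fin n) ℝ} {P : Fin N → Matrix (Fin n) (Fin n) ℝ}
    {Q R : Fin N → Matrix (Fin p) (Fin p) ℝ}
    (hdiss : ∀ i (x : Fin n → ℝ) (u : Fin p → ℝ),
      (A i *ᵥ x + B i *ᵥ u) ⬝ᵥ (P i *ᵥ (A i *ᵥ x + B i *ᵥ u)) - x ⬝ᵥ (P i *ᵥ x) ≤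
        (C i *ᵥ x + R i *ᵥ u) ⬝ᵥ u - (C i *ᵥ x) ⬝ᵥ (Q i *ᵥ (C i *ᵥ x)))
    (L : Matrix (Fin N × Fin p) (Fin N × Fin p) ℝ) (x : Fin N × Fin n → ℝ) :
    ((blkDiag A - blkDiag B * L * blkDiag C) *ᵥ x) ⬝ᵥ
        (blkDiag P *ᵥ ((blkDiag A - blkDiag B * L * blkDiag C) *ᵥ x)) ≤
      x ⬝ᵥ (blkDiag P *ᵥ x) -
        (blkDiag C *ᵥ x) ⬝ᵥ ((L - Lᵀ * blkDiag R * L + blkDiag Q) *ᵥ (blkDiag C *ᵥ x)) := by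
  set y := blkDiag C *ᵥ x with hy
  have hF : (blkDiag A - blkDiag B * L * blkDiag C) *ᵥ x =
      blkDiag A *ᵥ x + blkDiag B *ᵥ (-(L *ᵥ y)) := by
    rw [hy, sub_mulVec, ← mulVec_mulVec, ← mulVec_mulVec, mulVec_neg, sub_eq_add_neg]
  rw [hF]
  have hsum := Finset.sum_le_sum fun i (_ : i ∈ Finset.univ) =>
    hdiss i (Function.curry x i) (Function.curry (-(L *ᵥ y)) i)
  have hadd : ∀ {a : ℕ} (v w : Fin N × Fin a → ℝ) (i : Fin N),
      Function.curry v i + Function.curry w i = Function.curry (v + w) i := fun _ _ _ => rfl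
  simp only [← curry_blkDiag_mulVec, hadd, Finset.sum_sub_distrib,
    sum_curry_dotProduct_curry, ← hy] at hsum
  have hR : y ⬝ᵥ (Lᵀ *ᵥ (blkDiag R *ᵥ (L *ᵥ y))) =
      (blkDiag R *ᵥ (L *ᵥ y)) ⬝ᵥ (L *ᵥ y) := by
    rw [dotProduct_mulVec, vecMul_transpose, dotProduct_comm]
  simp only [add_mulVec, sub_mulVec, ← mulVec_mulVec, dotProduct_add, dotProduct_sub, hR]
  simp only [mulVec_neg, add_dotProduct, neg_dotProduct, dotProduct_neg] at hsum ⊢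
  linarith

/-- Output strictly passive (w.r.t. virtual outputs) detectable linear subsystems coupled
through a connected Laplacian: if `L − LᵀR̂L + Q̂ ≻ 0`, the network `x⁺ = (A − BLC)x`
is asymptotically stable. -/
theorem network_stability_linear_virtual_output {N n p : ℕ}
    (A : Fin N → Matrix (Fin n) (Fin n) ℝ)
    (B : Fin N → Matrix (Fin n) (Fin p) ℝ)
    (C : Fin N → Matrix (Fin p) (Fin n) ℝ)
    (hdet : ∀ i, ∀ ξ : ℕ → (Fin n → ℝ),
      (∀ k, ξ (k + 1) = A i *ᵥ ξ k) → (∀ k, C i *ᵥ ξ k = 0) →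
      Tendsto ξ atTop (nhds 0))
    (P : Fin N → Matrix (Fin n) (Fin n) ℝ)
    (hP : ∀ i, (P i).PosDef)
    (Qhat Rhat : Fin N → Matrix (Fin p) (Fin p) ℝ)
    (hQhatSymm : ∀ i, (Qhat i).IsSymm) (hRhatSymm : ∀ i, (Rhat i).IsSymm)
    (hdiss : ∀ i (x : Fin n → ℝ) (u : Fin p → ℝ),
      (A i *ᵥ x + B i *ᵥ u) ⬝ᵥ (P i *ᵥ (A i *ᵥ x + B i *ᵥ u)) - x ⬝ᵥ (P i *ᵥ x) ≤
        (C i *ᵥ x + Rhat i *ᵥ u) ⬝ᵥ u - (C i *ᵥ x) ⬝ᵥ (Qhat i *ᵥ (C i *ᵥ x)))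
    (𝒜 : Matrix (Fin N) (Fin N) ℝ)
    (h𝒜symm : 𝒜.IsSymm) (h𝒜nonneg : ∀ i j, 0 ≤ 𝒜 i j) (h𝒜diag : ∀ i, 𝒜 i i = 0)
    (ℒ : Matrix (Fin N) (Fin N) ℝ)
    (hℒ : ℒ = Matrix.diagonal (fun i => ∑ j, 𝒜 i j) - 𝒜)
    (hconn : ∀ v : Fin N → ℝ, ℒ *ᵥ v = 0 → ∃ c : ℝ, v = fun _ => c)
    (L : Matrix (Fin N × Fin p) (Fin N × Fin p) ℝ)
    (hL : L = ℒ ⊗ₖ (1 : Matrix (Fin p) (Fin p) ℝ))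
    (hLMI : (L - Lᵀ * blkDiag Rhat * L + blkDiag Qhat).PosDef) :
    ∀ x : ℕ → (Fin N × Fin n → ℝ),
      (∀ k, x (k + 1) = (blkDiag A - blkDiag B * L * blkDiag C) *ᵥ x k) →
      Tendsto x atTop (nhds 0) := by
  intro x hx
  set F := blkDiag A - blkDiag B * L * blkDiag C with hF
  have hdec := network_dissipation hdiss L
  rw [← hF] at hdec
  have hMpos : ∀ y, y ≠ 0 → 0 < y ⬝ᵥ ((L - Lᵀ * blkDiag Rhat * L + blkDiag Qhat) *ᵥ y) :=
    fun y hy => by simpa using hLMI.dotProduct_mulVec_pos hy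
  have hMnonneg : ∀ y, 0 ≤ y ⬝ᵥ ((L - Lᵀ * blkDiag Rhat * L + blkDiag Qhat) *ᵥ y) :=
    fun y => by simpa using hLMI.posSemidef.dotProduct_mulVec_nonneg y
  have hVcont : Continuous fun v : Fin N × Fin n → ℝ => v ⬝ᵥ (blkDiag P *ᵥ v) :=
    continuous_id.dotProduct (continuous_const.matrix_mulVec continuous_id)
  obtain ⟨c, hc, hVc⟩ := exists_pos_mul_norm_sq_le hVcont
    (fun v hv => dotProduct_blkDiag_mulVec_pos hP hv)
    fun t v => by simp only [mulVec_smul, smul_dotProduct, dotProduct_smul, smul_eq_mul]; ring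
  refine tendsto_zero_of_lyapunov (F := (F *ᵥ ·)) (continuous_const.matrix_mulVec continuous_id)
    hVcont (by simp) hc hVc (fun v => (hdec v).trans (sub_le_self _ (hMnonneg _)))
    (fun z hz => ?_) hx
  have hy : ∀ k, blkDiag C *ᵥ (F *ᵥ ·)^[k] z = 0 := fun k => by
    by_contra h
    have h1 := hdec ((F *ᵥ ·)^[k] z)
    have h2 := hz (k + 1)
    rw [Function.iterate_succ_apply'] at h2
    linarith [hMpos _ h, hz k]
  have hslice : ∀ i, Tendsto (fun k => Function.curry ((F *ᵥ ·)^[k] z) i) atTop (nhds 0) :=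
    fun i => by
      refine hdet i _ (fun k => ?_) fun k => ?_
      · have h : F *ᵥ ((F *ᵥ ·)^[k] z) = blkDiag A *ᵥ ((F *ᵥ ·)^[k] z) := by
          conv_lhs => rw [hF, sub_mulVec, ← mulVec_mulVec, hy k, mulVec_zero, sub_zero]
        rw [Function.iterate_succ_apply', h, curry_blkDiag_mulVec]
      · rw [← curry_blkDiag_mulVec, hy k]
        rfl
  exact tendsto_pi_nhds.2 fun ⟨i, r⟩ => tendsto_pi_nhds.1 (hslice i) r
end

section
/- Let ℒ be the weighted Laplacian of a connected undirected graph on N nodes with weighted degrees d_i > 0 for all i, and set L = ℒ ⊗ I_m. If Q̂_i, R̂_i ∈ ℝ^{m×m} are diagonal matrices satisfying 0 ≺ R̂_i ≺ (1/(2d_i))I and 0 ≺ Q̂_i ≺ d_i I for all i = 1,…,N, then, with Q̂ = diag(Q̂₁,…,Q̂_N) and R̂ = diag(R̂₁,…,R̂_N), the matrix inequality L − LᵀR̂L + Q̂ ≻ 0 holds. -/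
open Matrix Kronecker

/-- A block-diagonal matrix with diagonal blocks is diagonal. -/
lemma blkDiag_eq_diagonal {N m : ℕ} {M : Fin N → Matrix (Fin m) (Fin m) ℝ}
    (hM : ∀ i, (M i).IsDiag) :
    blkDiag M = Matrix.diagonal fun p : Fin N × Fin m => M p.1 p.2 p.2 := by
  ext ⟨i, k⟩ ⟨j, l⟩
  by_cases hij : i = j
  · subst hij
    by_cases hkl : k = l
    · subst hkl
      simp [blkDiag]
    · simp [blkDiag, hkl, hM i hkl]
  · simp [blkDiag, hij]

lemma laplacian_mulVec_apply {n : Type*} [Fintype n] [DecidableEq n]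
    (A : Matrix n n ℝ) (v : n → ℝ) (i : n) :
    ((Matrix.diagonal (fun i => ∑ j, A i j) - A) *ᵥ v) i = ∑ j, A i j * (v i - v j) := by
  rw [sub_mulVec, Pi.sub_apply, mulVec_diagonal]
  simp only [mul_sub, Finset.sum_sub_distrib, Finset.sum_mul, mulVec, dotProduct]

/-- The quadratic form of a weighted Laplacian as a sum over ordered pairs of nodes. -/
lemma dotProduct_laplacian_mulVec {n : Type*} [Fintype n] [DecidableEq n]
    {A : Matrix n n ℝ} (hA : A.IsSymm) (v : n → ℝ) :
    v ⬝ᵥ ((Matrix.diagonal (fun i => ∑ j, A i j) - A) *ᵥ v) =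
      (∑ i, ∑ j, A i j * (v i - v j) ^ 2) / 2 := by
  have h₁ : v ⬝ᵥ ((Matrix.diagonal (fun i => ∑ j, A i j) - A) *ᵥ v) =
      ∑ i, ∑ j, A i j * (v i * (v i - v j)) := by
    simp only [dotProduct, laplacian_mulVec_apply, Finset.mul_sum]
    exact Finset.sum_congr rfl fun i _ => Finset.sum_congr rfl fun j _ => by ring
  have h₂ : ∑ i, ∑ j, A i j * (v i * (v i - v j)) = ∑ i, ∑ j, A i j * (v j * (v j - v i)) := by
    rw [Finset.sum_comm]
    exact Finset.sum_congr rfl fun i _ => Finset.sum_congr rfl fun j _ => by rw [hA.apply i j]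
  have h₃ : ∑ i, ∑ j, A i j * (v i - v j) ^ 2 =
      ∑ i, ∑ j, A i j * (v i * (v i - v j)) + ∑ i, ∑ j, A i j * (v j * (v j - v i)) := by
    simp only [← Finset.sum_add_distrib]
    exact Finset.sum_congr rfl fun i _ => Finset.sum_congr rfl fun j _ => by ring
  linarith

/-- The Laplacian `ℒ` dominates `ℒᵀ diag(r) ℒ` as soon as `2 rᵢ dᵢ ≤ 1` for all nodes `i`. -/
lemma sum_mul_sq_laplacian_mulVec_le {n : Type*} [Fintype n] [DecidableEq n]
    {A : Matrix n n ℝ} (hA : A.IsSymm) (hA₀ : ∀ i j, 0 ≤ A i j) {r : n → ℝ}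
    (hr₀ : ∀ i, 0 ≤ r i) (hr : ∀ i, r i * ∑ j, A i j ≤ 1 / 2) (v : n → ℝ) :
    ∑ i, r i * ((Matrix.diagonal (fun i => ∑ j, A i j) - A) *ᵥ v) i ^ 2 ≤
      v ⬝ᵥ ((Matrix.diagonal (fun i => ∑ j, A i j) - A) *ᵥ v) := by
  rw [dotProduct_laplacian_mulVec hA, Finset.sum_div]
  refine Finset.sum_le_sum fun i _ => ?_
  rw [laplacian_mulVec_apply]
  have hnonneg : ∀ j, 0 ≤ A i j * (v i - v j) ^ 2 := fun j => mul_nonneg (hA₀ i j) (sq_nonneg _)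
  have hCS : (∑ j, A i j * (v i - v j)) ^ 2 ≤
      (∑ j, A i j) * ∑ j, A i j * (v i - v j) ^ 2 :=
    Finset.sum_sq_le_sum_mul_sum_of_sq_le_mul _ (fun j _ => hA₀ i j) (fun j _ => hnonneg j)
      fun j _ => (by ring : _ = _).le
  calc r i * (∑ j, A i j * (v i - v j)) ^ 2
      ≤ r i * ((∑ j, A i j) * ∑ j, A i j * (v i - v j) ^ 2) :=
        mul_le_mul_of_nonneg_left hCS (hr₀ i)
    _ = (r i * ∑ j, A i j) * ∑ j, A i j * (v i - v j) ^ 2 := by ring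
    _ ≤ 1 / 2 * ∑ j, A i j * (v i - v j) ^ 2 :=
        mul_le_mul_of_nonneg_right (hr i) (Finset.sum_nonneg fun j _ => hnonneg j)
    _ = (∑ j, A i j * (v i - v j) ^ 2) / 2 := by ring

lemma kronecker_one_mulVec_apply {n m : Type*} [Fintype n] [Fintype m] [DecidableEq m]
    (M : Matrix n n ℝ) (x : n × m → ℝ) (i : n) (k : m) :
    ((M ⊗ₖ (1 : Matrix m m ℝ)) *ᵥ x) (i, k) = (M *ᵥ fun j => x (j, k)) i := by
  simp [mulVec, dotProduct, Fintype.sum_prod_type, Matrix.one_apply]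

/-- The Kronecker-lifted form of `sum_mul_sq_laplacian_mulVec_le`. -/
lemma posSemidef_kronecker_laplacian_sub {n m : Type*} [Fintype n] [DecidableEq n]
    [Fintype m] [DecidableEq m] {A : Matrix n n ℝ} (hA : A.IsSymm) (hA₀ : ∀ i j, 0 ≤ A i j)
    {L : Matrix (n × m) (n × m) ℝ}
    (hL : L = (Matrix.diagonal (fun i => ∑ j, A i j) - A) ⊗ₖ (1 : Matrix m m ℝ))
    {r : n × m → ℝ} (hr₀ : ∀ p, 0 ≤ r p) (hr : ∀ p, r p * ∑ j, A p.1 j ≤ 1 / 2) :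
    (L - Lᵀ * Matrix.diagonal r * L).PosSemidef := by
  have hLsymm : Lᵀ = L := by
    rw [hL, ← kroneckerMap_transpose, transpose_sub, diagonal_transpose, hA.eq, transpose_one]
  refine PosSemidef.of_dotProduct_mulVec_nonneg ?_ fun x => ?_
  · rw [IsHermitian, conjTranspose_eq_transpose_of_trivial]
    simp [hLsymm, Matrix.mul_assoc]
  · have hquad : x ⬝ᵥ ((Lᵀ * Matrix.diagonal r * L) *ᵥ x) = ∑ p, r p * (L *ᵥ x) p ^ 2 := by
      rw [Matrix.mul_assoc, ← mulVec_mulVec, ← mulVec_mulVec, dotProduct_mulVec,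
        vecMul_transpose]
      simp only [dotProduct, mulVec_diagonal]
      exact Finset.sum_congr rfl fun p _ => by ring
    rw [star_trivial, sub_mulVec, dotProduct_sub, hquad, sub_nonneg, hL]
    simp only [dotProduct, Fintype.sum_prod_type_right, kronecker_one_mulVec_apply]
    exact Finset.sum_le_sum fun k _ => sum_mul_sq_laplacian_mulVec_le hA hA₀
      (fun i => hr₀ (i, k)) (fun i => hr (i, k)) fun j => x (j, k)

/-- Decentralized sufficient conditions via diagonal dominance: if `Q̂_i, R̂_i` are diagonal
with `0 ≺ R̂_i ≺ (1/(2d_i))I` and `0 ≺ Q̂_i ≺ d_i I`, then `L − LᵀR̂L + Q̂ ≻ 0`. -/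
theorem decentralized_diagonal_conditions {N m : ℕ}
    (𝒜 : Matrix (Fin N) (Fin N) ℝ)
    (h𝒜symm : 𝒜.IsSymm) (h𝒜nonneg : ∀ i j, 0 ≤ 𝒜 i j) (h𝒜diag : ∀ i, 𝒜 i i = 0)
    (d : Fin N → ℝ) (hd : ∀ i, d i = ∑ j, 𝒜 i j) (hdpos : ∀ i, 0 < d i)
    (ℒ : Matrix (Fin N) (Fin N) ℝ) (hℒ : ℒ = Matrix.diagonal d - 𝒜)
    (hconn : ∀ v : Fin N → ℝ, ℒ *ᵥ v = 0 → ∃ c : ℝ, v = fun _ => c)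
    (L : Matrix (Fin N × Fin m) (Fin N × Fin m) ℝ)
    (hL : L = ℒ ⊗ₖ (1 : Matrix (Fin m) (Fin m) ℝ))
    (Qhat Rhat : Fin N → Matrix (Fin m) (Fin m) ℝ)
    (hQdiag : ∀ i, (Qhat i).IsDiag) (hRdiag : ∀ i, (Rhat i).IsDiag)
    (hRpos : ∀ i, (Rhat i).PosDef)
    (hRub : ∀ i, ((1 / (2 * d i)) • (1 : Matrix (Fin m) (Fin m) ℝ) - Rhat i).PosDef)
    (hQpos : ∀ i, (Qhat i).PosDef)
    (hQub : ∀ i, (d i • (1 : Matrix (Fin m) (Fin m) ℝ) - Qhat i).PosDef) :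
    (L - Lᵀ * blkDiag Rhat * L + blkDiag Qhat).PosDef := by
  have hR : ∀ p : Fin N × Fin m, Rhat p.1 p.2 p.2 * ∑ j, 𝒜 p.1 j ≤ 1 / 2 := by
    rintro ⟨i, k⟩
    have h := (hRub i).diag_pos (i := k)
    simp only [Matrix.sub_apply, Matrix.smul_apply, one_apply_eq, smul_eq_mul, mul_one, sub_pos] at h
    rw [← hd i]
    calc Rhat i k k * d i ≤ 1 / (2 * d i) * d i := mul_le_mul_of_nonneg_right h.le (hdpos i).le
      _ = 1 / 2 := by field_simp [(hdpos i).ne']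
  rw [blkDiag_eq_diagonal hQdiag, blkDiag_eq_diagonal hRdiag]
  refine PosDef.posSemidef_add ?_ (PosDef.diagonal fun p => (hQpos p.1).diag_pos)
  exact posSemidef_kronecker_laplacian_sub h𝒜symm h𝒜nonneg (by rw [hL, hℒ, funext hd])
    (fun p => (hRpos p.1).diag_pos.le) hR
end

section
/- For i = 1,…,N let f_i : ℝⁿ × ℝᵐ → ℝⁿ be continuous with f_i(0,0) = 0 and h_i : ℝⁿ → ℝᵖ be continuous with h_i(0) = 0. Let H ∈ ℝ^{Nm×Np}, and define the network map F : ℝ^{Nn} → ℝ^{Nn} by F(x)_i = f_i(x_i, u_i) where u = Hh(x) ∈ ℝ^{Nm} and h(x) ∈ ℝ^{Np} stacks the h_i(x_i). Suppose each subsystem is (Q_i,S_i,R_i)-dissipative with a continuous positive definite storage function V_i : ℝⁿ → ℝ (V_i(0) = 0 and V_i(ξ) > 0 for ξ ≠ 0): V_i(f_i(ξ,v)) − V_i(ξ) ≤ h_i(ξ)ᵀQ_i h_i(ξ) + 2h_i(ξ)ᵀS_i v + vᵀR_i v for all ξ ∈ ℝⁿ, v ∈ ℝᵐ. If, with Q =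 diag(Q₁,…,Q_N), S = diag(S₁,…,S_N), R = diag(R₁,…,R_N), the matrix inequality Q + SH + HᵀSᵀ + HᵀRH ≺ 0 holds, then the origin is a stable equilibrium of x⁺ = F(x): F(0) = 0 and for every ε > 0 there exists δ > 0 such that ‖x₀‖ ≤ δ implies ‖F^{(k)}(x₀)‖ ≤ ε for all k ≥ 0. -/
open Matrix

/-- A block-diagonal bilinear form is the sum of the bilinear forms of its blocks. -/
lemma dotProduct_blkDiag_mulVec {N a b : ℕ} (M : Fin N → Matrix (Fin a) (Fin b) ℝ)
    (w : Fin N × Fin a → ℝ) (z : Fin N × Fin b → ℝ) :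
    w ⬝ᵥ (blkDiag M *ᵥ z) = ∑ i, (fun c => w (i, c)) ⬝ᵥ (M i *ᵥ fun c => z (i, c)) := by
  simp only [dotProduct, mulVec, Fintype.sum_prod_type, blkDiag, Matrix.of_apply, ite_mul,
    zero_mul]
  refine Finset.sum_congr rfl fun i _ => Finset.sum_congr rfl fun c _ => ?_
  congr 1
  rw [Finset.sum_eq_single i] <;> simp +contextual [eq_comm]

/-- The quadratic form of the interconnection matrix is the supply rate along `u = Hy`. -/
lemma dotProduct_interconnection_mulVec {ι κ : Type*} [Fintype ι] [Fintype κ]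
    (A : Matrix ι ι ℝ) (B : Matrix ι κ ℝ) (C : Matrix κ κ ℝ) (H : Matrix κ ι ℝ) (y : ι → ℝ) :
    y ⬝ᵥ ((A + B * H + Hᵀ * Bᵀ + Hᵀ * C * H) *ᵥ y) =
      y ⬝ᵥ (A *ᵥ y) + 2 * (y ⬝ᵥ (B *ᵥ (H *ᵥ y))) + (H *ᵥ y) ⬝ᵥ (C *ᵥ (H *ᵥ y)) := by
  have key (w : κ → ℝ) : y ⬝ᵥ (Hᵀ *ᵥ w) = (H *ᵥ y) ⬝ᵥ w := by
    rw [dotProduct_mulVec, vecMul_transpose]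
  have hB : (H *ᵥ y) ⬝ᵥ (Bᵀ *ᵥ y) = y ⬝ᵥ (B *ᵥ (H *ᵥ y)) := by
    rw [dotProduct_comm, mulVec_transpose, ← dotProduct_mulVec]
  simp only [add_mulVec, dotProduct_add, ← mulVec_mulVec, key, hB]
  ring

/-- Lyapunov's direct method for a fixed point of a discrete-time system. -/
lemma stable_of_lyapunov {E : Type*} [NormedAddCommGroup E] [ProperSpace E]
    {F : E → E} (hFc : Continuous F) (hF0 : F 0 = 0) {W : E → ℝ} (hWc : Continuous W)
    (hW0 : W 0 = 0) (hWpos : ∀ x, x ≠ 0 → 0 < W x) (hW : ∀ x, W (F x) ≤ W x) :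
    ∀ ε > (0 : ℝ), ∃ δ > (0 : ℝ), ∀ x, ‖x‖ ≤ δ → ∀ k : ℕ, ‖F^[k] x‖ ≤ ε := by
  intro ε hε
  obtain ⟨r₀, hr₀, hFr₀⟩ := Metric.continuous_iff.1 hFc 0 ε hε
  simp only [hF0, dist_zero_right] at hFr₀
  obtain ⟨r, hr, hrr₀, hrε⟩ : ∃ r > 0, r < r₀ ∧ r ≤ ε :=
    ⟨min (r₀ / 2) ε, by positivity, (min_le_left _ _).trans_lt (by linarith), min_le_right _ _⟩
  have hK : IsCompact (Metric.closedBall (0 : E) ε ∩ {x | r ≤ ‖x‖}) :=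
    (isCompact_closedBall 0 ε).inter_right (isClosed_le continuous_const continuous_norm)
  obtain ⟨α, hα, hαW⟩ := hK.exists_forall_le' hWc.continuousOn (a := 0) fun x hx =>
    hWpos x (norm_pos_iff.1 (hr.trans_le hx.2))
  obtain ⟨s, hs, hsW⟩ := Metric.continuous_iff.1 hWc 0 α hα
  simp only [hW0, dist_zero_right] at hsW
  refine ⟨min r (s / 2), by positivity, fun x hx k => ?_⟩
  suffices ‖F^[k] x‖ ≤ r ∧ W (F^[k] x) < α from this.1.trans hrε
  induction k with
  | zero =>
    have hxs : ‖x‖ < s := (hx.trans (min_le_right _ _)).trans_lt (by linarith)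
    exact ⟨hx.trans (min_le_left _ _), (le_abs_self _).trans_lt (hsW x hxs)⟩
  | succ k ih =>
    rw [Function.iterate_succ_apply']
    have hlt := (hW (F^[k] x)).trans_lt ih.2
    refine ⟨?_, hlt⟩
    by_contra! hcon
    exact (hαW _ ⟨mem_closedBall_zero_iff.2 (hFr₀ _ (ih.1.trans_lt hrr₀)).le, hcon.le⟩).not_gt hlt

/-- Interconnection of (Q_i,S_i,R_i)-dissipative nonlinear discrete-time subsystems
through `u = Hy`: if `Q + SH + HᵀSᵀ + HᵀRH ≺ 0`, the origin of the network
`x⁺ = F(x)` is a stable equilibrium. -/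
theorem network_stability_nonlinear {N n m p : ℕ}
    (f : Fin N → (Fin n → ℝ) → (Fin m → ℝ) → (Fin n → ℝ))
    (hfc : ∀ i, Continuous fun q : (Fin n → ℝ) × (Fin m → ℝ) => f i q.1 q.2)
    (hf0 : ∀ i, f i 0 0 = 0)
    (h : Fin N → (Fin n → ℝ) → (Fin p → ℝ))
    (hhc : ∀ i, Continuous (h i)) (hh0 : ∀ i, h i 0 = 0)
    (H : Matrix (Fin N × Fin m) (Fin N × Fin p) ℝ)
    (F : (Fin N × Fin n → ℝ) → (Fin N × Fin n → ℝ))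
    (hF : ∀ (x : Fin N × Fin n → ℝ) (i : Fin N) (a : Fin n),
      F x (i, a) =
        f i (fun b => x (i, b))
          (fun c =>
            (H *ᵥ fun jp : Fin N × Fin p => h jp.1 (fun b => x (jp.1, b)) jp.2) (i, c)) a)
    (Q : Fin N → Matrix (Fin p) (Fin p) ℝ)
    (S : Fin N → Matrix (Fin p) (Fin m) ℝ)
    (R : Fin N → Matrix (Fin m) (Fin m) ℝ)
    (hQsymm : ∀ i, (Q i).IsSymm) (hRsymm : ∀ i, (R i).IsSymm)
    (V : Fin N → (Fin n → ℝ) → ℝ)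
    (hVc : ∀ i, Continuous (V i)) (hV0 : ∀ i, V i 0 = 0)
    (hVpos : ∀ i (ξ : Fin n → ℝ), ξ ≠ 0 → 0 < V i ξ)
    (hdiss : ∀ i (ξ : Fin n → ℝ) (v : Fin m → ℝ),
      V i (f i ξ v) - V i ξ ≤
        h i ξ ⬝ᵥ (Q i *ᵥ h i ξ) + 2 * (h i ξ ⬝ᵥ (S i *ᵥ v)) + v ⬝ᵥ (R i *ᵥ v))
    (hLMI : (-(blkDiag Q + blkDiag S * H + Hᵀ * (blkDiag S)ᵀ
        + Hᵀ * blkDiag R * H)).PosDef) :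
    F 0 = 0 ∧
    ∀ ε > (0 : ℝ), ∃ δ > (0 : ℝ), ∀ x0 : Fin N × Fin n → ℝ,
      ‖x0‖ ≤ δ → ∀ k : ℕ, ‖F^[k] x0‖ ≤ ε := by
  have hF' (x : Fin N × Fin n → ℝ) (i : Fin N) : (fun a => F x (i, a)) = _ :=
    funext fun a => hF x i a
  have hyc : Continuous fun (x : Fin N × Fin n → ℝ) (jp : Fin N × Fin p) =>
      h jp.1 (fun b => x (jp.1, b)) jp.2 :=
    continuous_pi fun jp => (continuous_apply jp.2).comp ((hhc jp.1).comp (by fun_prop))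
  have hFc : Continuous F := by
    refine continuous_pi fun ⟨i, a⟩ => ?_
    simp only [hF]
    have huc := (continuous_const (y := H)).matrix_mulVec hyc
    exact (continuous_apply a).comp ((hfc i).comp (Continuous.prodMk (by fun_prop)
      (continuous_pi fun c => (continuous_apply (i, c)).comp huc)))
  have hF0 : F 0 = 0 := by
    ext ⟨i, a⟩
    have hy : (fun jp : Fin N × Fin p =>
        h jp.1 (fun b => (0 : Fin N × Fin n → ℝ) (jp.1, b)) jp.2) = 0 :=
      funext fun jp => congrFun (hh0 jp.1) jp.2
    rw [hF, hy, mulVec_zero]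
    exact congrFun (hf0 i) a
  have hVnn (i : Fin N) (ξ : Fin n → ℝ) : 0 ≤ V i ξ := by
    rcases eq_or_ne ξ 0 with rfl | hξ
    · exact (hV0 i).ge
    · exact (hVpos i ξ hξ).le
  refine ⟨hF0, stable_of_lyapunov hFc hF0 (W := fun x => ∑ i, V i fun a => x (i, a)) ?_ ?_ ?_ ?_⟩
  · exact continuous_finsetSum _ fun i _ => (hVc i).comp (by fun_prop)
  · exact Finset.sum_eq_zero fun i _ => hV0 i
  · intro x hx
    obtain ⟨⟨i, a⟩, hia⟩ := Function.ne_iff.1 hx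
    exact Finset.sum_pos' (fun j _ => hVnn j _)
      ⟨i, Finset.mem_univ i, hVpos i _ (Function.ne_iff.2 ⟨a, hia⟩)⟩
  · intro x
    set y : Fin N × Fin p → ℝ := fun jp => h jp.1 (fun b => x (jp.1, b)) jp.2
    have hneg := hLMI.posSemidef.dotProduct_mulVec_nonneg y
    rw [star_trivial, neg_mulVec, dotProduct_neg, dotProduct_interconnection_mulVec,
      dotProduct_blkDiag_mulVec, dotProduct_blkDiag_mulVec, dotProduct_blkDiag_mulVec,
      Finset.mul_sum, ← Finset.sum_add_distrib, ← Finset.sum_add_distrib] at hneg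
    have hsum := Finset.sum_le_sum fun i (_ : i ∈ Finset.univ) =>
      hdiss i (fun b => x (i, b)) (fun c => (H *ᵥ y) (i, c))
    rw [Finset.sum_sub_distrib] at hsum
    simp only [hF']
    linarith
end

section
/- Let Q ∈ ℝ^{a×a} be symmetric with Q ≺ 0, R ∈ ℝ^{b×b} symmetric with R ≻ 0, S ∈ ℝ^{a×b}, and H ∈ ℝ^{b×a}. Then the block matrix M = [[Q, S], [Sᵀ, R]] is invertible; writing M⁻¹ = [[𝒬, 𝒮], [𝒮ᵀ, ℛ]] with 𝒬 ∈ ℝ^{a×a}, 𝒮 ∈ ℝ^{a×b}, ℛ ∈ ℝ^{b×b}, one has 𝒬 ≺ 0 and ℛ ≻ 0, and the primal inequality Q + SH + HᵀSᵀ + HᵀRH ≺ 0 holds if and only if the dual inequality H𝒬Hᵀ − H𝒮 − 𝒮ᵀHᵀ + ℛ ≻ 0 holds. -/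
open Matrix

namespace Matrix

variable {m n : Type*} [Fintype m] [Fintype n] [DecidableEq n]

/-- The negated Schur complement of `R` in `[[Q, S], [Sᵀ, R]]` is positive definite if
`Q ≺ 0` and `R ≻ 0`. -/
theorem PosDef.mul_inv_mul_transpose_sub {Q : Matrix m m ℝ} {R : Matrix n n ℝ}
    (hQ : (-Q).PosDef) (hR : R.PosDef) (S : Matrix m n ℝ) : (S * R⁻¹ * Sᵀ - Q).PosDef := by
  have h := hQ.add_posSemidef (hR.inv.posSemidef.mul_mul_conjTranspose_same S)
  rwa [conjTranspose_eq_transpose_of_trivial, neg_add_eq_sub] at h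

variable [DecidableEq m]

/-- The two Schur complements of a real symmetric block matrix with positive definite diagonal
blocks are simultaneously positive definite. -/
theorem PosDef.schur_complement_comm {A : Matrix m m ℝ} {D : Matrix n n ℝ} (hA : A.PosDef)
    (hD : D.PosDef) (B : Matrix m n ℝ) :
    (A - B * D⁻¹ * Bᵀ).PosDef ↔ (D - Bᵀ * A⁻¹ * B).PosDef := by
  let := hA.isUnit.invertible
  let := hD.isUnit.invertible
  have hunit : IsUnit (A - B * D⁻¹ * Bᵀ) ↔ IsUnit (D - Bᵀ * A⁻¹ * B) := by
    rw [← invOf_eq_nonsing_inv D, ← invOf_eq_nonsing_inv A,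
      ← isUnit_fromBlocks_iff_of_invertible₂₂, isUnit_fromBlocks_iff_of_invertible₁₁]
  have hpsd : (A - B * D⁻¹ * Bᵀ).PosSemidef ↔ (D - Bᵀ * A⁻¹ * B).PosSemidef := by
    have h := (PosDef.fromBlocks₂₂ A B hD).symm.trans (PosDef.fromBlocks₁₁ B D hA)
    rwa [conjTranspose_eq_transpose_of_trivial] at h
  exact ⟨fun h => (hpsd.1 h.posSemidef).posDef_iff_isUnit.2 (hunit.1 h.isUnit),
    fun h => (hpsd.2 h.posSemidef).posDef_iff_isUnit.2 (hunit.2 h.isUnit)⟩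

theorem isUnit_fromBlocks_of_neg_posDef_of_posDef {Q : Matrix m m ℝ} {R : Matrix n n ℝ}
    (hQ : (-Q).PosDef) (hR : R.PosDef) (S : Matrix m n ℝ) : IsUnit (fromBlocks Q S Sᵀ R) := by
  let := hR.isUnit.invertible
  rw [isUnit_fromBlocks_iff_of_invertible₂₂, invOf_eq_nonsing_inv, ← IsUnit.neg_iff, neg_sub]
  exact (hQ.mul_inv_mul_transpose_sub hR S).isUnit

theorem inv_fromBlocks_of_neg_posDef_of_posDef {Q : Matrix m m ℝ} {R : Matrix n n ℝ}
    (hQ : (-Q).PosDef) (hR : R.PosDef) (S : Matrix m n ℝ) :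
    (fromBlocks Q S Sᵀ R)⁻¹ =
      fromBlocks (-(S * R⁻¹ * Sᵀ - Q)⁻¹) ((S * R⁻¹ * Sᵀ - Q)⁻¹ * S * R⁻¹)
        (R⁻¹ * Sᵀ * (S * R⁻¹ * Sᵀ - Q)⁻¹)
        (R⁻¹ - R⁻¹ * Sᵀ * (S * R⁻¹ * Sᵀ - Q)⁻¹ * S * R⁻¹) := by
  have hT := (hQ.mul_inv_mul_transpose_sub hR S).isUnit
  let := hR.isUnit.invertible
  let := (isUnit_fromBlocks_of_neg_posDef_of_posDef hQ hR S).invertible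
  let : Invertible (Q - S * ⅟R * Sᵀ) := invertibleOfFromBlocks₂₂Invertible Q S Sᵀ R
  have hE : (Q - S * R⁻¹ * Sᵀ)⁻¹ = -(S * R⁻¹ * Sᵀ - Q)⁻¹ := by
    refine inv_eq_right_inv ?_
    rw [← neg_sub, neg_mul_neg, mul_nonsing_inv _ ((isUnit_iff_isUnit_det _).1 hT)]
  rw [← invOf_eq_nonsing_inv (fromBlocks Q S Sᵀ R), invOf_fromBlocks₂₂_eq]
  simp only [invOf_eq_nonsing_inv, hE, Matrix.neg_mul, Matrix.mul_neg, neg_neg,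
    ← sub_eq_add_neg]

/-- The primal inequality for `[[Q, S], [Sᵀ, R]]` is equivalent to the dual inequality for its
inverse. -/
theorem neg_posDef_iff_dual_posDef {Q : Matrix m m ℝ} {R : Matrix n n ℝ}
    (hQ : (-Q).PosDef) (hR : R.PosDef) (S : Matrix m n ℝ) (H : Matrix n m ℝ) :
    (-(Q + S * H + Hᵀ * Sᵀ + Hᵀ * R * H)).PosDef ↔
      (H * (fromBlocks Q S Sᵀ R)⁻¹.toBlocks₁₁ * Hᵀ
        - H * (fromBlocks Q S Sᵀ R)⁻¹.toBlocks₁₂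
        - ((fromBlocks Q S Sᵀ R)⁻¹.toBlocks₁₂)ᵀ * Hᵀ
        + (fromBlocks Q S Sᵀ R)⁻¹.toBlocks₂₂).PosDef := by
  have hT := hQ.mul_inv_mul_transpose_sub hR S
  have hTt : ((S * R⁻¹ * Sᵀ - Q)⁻¹)ᵀ = (S * R⁻¹ * Sᵀ - Q)⁻¹ := hT.inv.isHermitian
  have hRt : (R⁻¹)ᵀ = R⁻¹ := hR.inv.isHermitian
  have hRdet : IsUnit R.det := (isUnit_iff_isUnit_det _).1 hR.isUnit
  have key := hT.schur_complement_comm hR.inv (Hᵀ + S * R⁻¹)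
  rw [inv_fromBlocks_of_neg_posDef_of_posDef hQ hR S]
  simp only [toBlocks_fromBlocks₁₁, toBlocks_fromBlocks₁₂, toBlocks_fromBlocks₂₂]
  generalize (S * R⁻¹ * Sᵀ - Q)⁻¹ = V at *
  convert key using 2
  · simp only [transpose_add, transpose_mul, transpose_transpose, hRt, Matrix.mul_add,
      Matrix.add_mul, Matrix.mul_assoc, nonsing_inv_nonsing_inv R hRdet,
      mul_nonsing_inv_cancel_left _ _ hRdet, nonsing_inv_mul_cancel_left _ _ hRdet]
    abel
  · simp only [transpose_add, transpose_mul, transpose_transpose, hRt, hTt, Matrix.mul_add,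
      Matrix.add_mul, Matrix.mul_assoc, Matrix.neg_mul, Matrix.mul_neg]
    abel

end Matrix

/-- Dualization: for `Q ≺ 0` and `R ≻ 0` the supply matrix `[[Q,S],[Sᵀ,R]]` is invertible,
the blocks `𝒬, ℛ` of its inverse satisfy `𝒬 ≺ 0` and `ℛ ≻ 0`, and the primal inequality
`Q + SH + HᵀSᵀ + HᵀRH ≺ 0` holds iff the dual inequality `H𝒬Hᵀ − H𝒮 − 𝒮ᵀHᵀ + ℛ ≻ 0`
holds. -/
theorem dualization_primal_iff_dual {a b : ℕ}
    (Q : Matrix (Fin a) (Fin a) ℝ) (hQsymm : Q.IsSymm) (hQneg : (-Q).PosDef)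
    (R : Matrix (Fin b) (Fin b) ℝ) (hRsymm : R.IsSymm) (hRpos : R.PosDef)
    (S : Matrix (Fin a) (Fin b) ℝ) (H : Matrix (Fin b) (Fin a) ℝ) :
    IsUnit (Matrix.fromBlocks Q S Sᵀ R) ∧
    (-((Matrix.fromBlocks Q S Sᵀ R)⁻¹.toBlocks₁₁)).PosDef ∧
    ((Matrix.fromBlocks Q S Sᵀ R)⁻¹.toBlocks₂₂).PosDef ∧
    ((-(Q + S * H + Hᵀ * Sᵀ + Hᵀ * R * H)).PosDef ↔
      (H * (Matrix.fromBlocks Q S Sᵀ R)⁻¹.toBlocks₁₁ * Hᵀ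
        - H * (Matrix.fromBlocks Q S Sᵀ R)⁻¹.toBlocks₁₂
        - ((Matrix.fromBlocks Q S Sᵀ R)⁻¹.toBlocks₁₂)ᵀ * Hᵀ
        + (Matrix.fromBlocks Q S Sᵀ R)⁻¹.toBlocks₂₂).PosDef) := by
  refine ⟨isUnit_fromBlocks_of_neg_posDef_of_posDef hQneg hRpos S, ?_, ?_,
    neg_posDef_iff_dual_posDef hQneg hRpos S H⟩
  · rw [inv_fromBlocks_of_neg_posDef_of_posDef hQneg hRpos S, toBlocks_fromBlocks₁₁, neg_neg]
    exact (hQneg.mul_inv_mul_transpose_sub hRpos S).inv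
  · simpa using (neg_posDef_iff_dual_posDef hQneg hRpos S 0).1 (by simpa using hQneg)
end

section
/- Let ℒ = 𝒟 − 𝒜 be the weighted Laplacian of a connected undirected graph on N nodes (the kernel of ℒ is spanned by the all-ones vector 𝟏), with weighted degrees d_i > 0 for all i and d_min = min_i d_i. Then the regularized Laplacian ℒ + (d_min/N)𝟏𝟏ᵀ is positive definite and its inverse satisfies (ℒ + (d_min/N)𝟏𝟏ᵀ)⁻¹ ⪰ (1/3)𝒟⁻¹ (this is equivalent to the pseudoinverse bound ℒ† + (1/(d_min N))𝟏𝟏ᵀ ⪰ (1/3)𝒟⁻¹). -/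
open Matrix

/-- Inversion is antitone on positive definite matrices. -/
theorem posSemidef_inv_sub_inv {n : Type*} [Fintype n] [DecidableEq n]
    {M E : Matrix n n ℝ} (hM : M.PosDef) (hE : E.PosDef) (h : (E - M).PosSemidef) :
    (M⁻¹ - E⁻¹).PosSemidef := by
  have hMu : IsUnit M.det := (Matrix.isUnit_iff_isUnit_det _).1 hM.isUnit
  have hEu : IsUnit E.det := (Matrix.isUnit_iff_isUnit_det _).1 hE.isUnit
  have hMi : (M⁻¹)ᴴ = M⁻¹ := hM.isHermitian.inv
  have hEi : (E⁻¹)ᴴ = E⁻¹ := hE.isHermitian.inv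
  have key : M⁻¹ - E⁻¹ =
      (M⁻¹ - E⁻¹)ᴴ * M * (M⁻¹ - E⁻¹) + (E⁻¹)ᴴ * (E - M) * E⁻¹ := by
    rw [conjTranspose_sub, hMi, hEi]
    simp only [sub_mul, mul_sub, Matrix.nonsing_inv_mul _ hMu, Matrix.nonsing_inv_mul _ hEu,
      Matrix.mul_assoc, Matrix.mul_nonsing_inv _ hMu, Matrix.one_mul, Matrix.mul_one]
    abel
  rw [key]
  exact (hM.posSemidef.conjTranspose_mul_mul_same _).add (h.conjTranspose_mul_mul_same _)

section WeightedGraph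

variable {n : Type*} [Fintype n] {A : Matrix n n ℝ} {d : n → ℝ}

theorem sum_mul_sq_eq_of_isSymm (hA : A.IsSymm) (hd : ∀ i, d i = ∑ j, A i j) (x : n → ℝ) :
    ∑ i, ∑ j, A i j * x j ^ 2 = ∑ i, d i * x i ^ 2 := by
  rw [Finset.sum_comm]
  refine Finset.sum_congr rfl fun i _ => ?_
  rw [hd, Finset.sum_mul]
  exact Finset.sum_congr rfl fun j _ => by rw [hA.apply]

theorem dotProduct_mulVec_eq_sum (A : Matrix n n ℝ) (x : n → ℝ) :
    x ⬝ᵥ (A *ᵥ x) = ∑ i, ∑ j, A i j * (x i * x j) := by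
  simp only [dotProduct, mulVec, Finset.mul_sum]
  exact Finset.sum_congr rfl fun i _ => Finset.sum_congr rfl fun j _ => by ring

theorem dotProduct_diagonal_mulVec [DecidableEq n] (d x : n → ℝ) :
    x ⬝ᵥ (diagonal d *ᵥ x) = ∑ i, d i * x i ^ 2 := by
  simp only [dotProduct, mulVec_diagonal]
  exact Finset.sum_congr rfl fun i _ => by ring

theorem abs_dotProduct_mulVec_le [DecidableEq n] (hA : A.IsSymm) (hA0 : ∀ i j, 0 ≤ A i j)
    (hd : ∀ i, d i = ∑ j, A i j) (x : n → ℝ) :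
    |x ⬝ᵥ (A *ᵥ x)| ≤ x ⬝ᵥ (diagonal d *ᵥ x) := by
  have h1 : ∑ i, ∑ j, A i j * x i ^ 2 = ∑ i, d i * x i ^ 2 :=
    Finset.sum_congr rfl fun i _ => by rw [hd, Finset.sum_mul]
  have h2 := sum_mul_sq_eq_of_isSymm hA hd x
  have hsub : 0 ≤ ∑ i, ∑ j, A i j * (x i - x j) ^ 2 :=
    Finset.sum_nonneg fun i _ => Finset.sum_nonneg fun j _ => mul_nonneg (hA0 i j) (sq_nonneg _)
  have hadd : 0 ≤ ∑ i, ∑ j, A i j * (x i + x j) ^ 2 :=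
    Finset.sum_nonneg fun i _ => Finset.sum_nonneg fun j _ => mul_nonneg (hA0 i j) (sq_nonneg _)
  have esub : ∑ i, ∑ j, A i j * (x i - x j) ^ 2 = ∑ i, ∑ j, A i j * x i ^ 2
      + ∑ i, ∑ j, A i j * x j ^ 2 - 2 * ∑ i, ∑ j, A i j * (x i * x j) := by
    simp only [Finset.mul_sum, ← Finset.sum_add_distrib, ← Finset.sum_sub_distrib]
    exact Finset.sum_congr rfl fun i _ => Finset.sum_congr rfl fun j _ => by ring
  have eadd : ∑ i, ∑ j, A i j * (x i + x j) ^ 2 = ∑ i, ∑ j, A i j * x i ^ 2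
      + ∑ i, ∑ j, A i j * x j ^ 2 + 2 * ∑ i, ∑ j, A i j * (x i * x j) := by
    simp only [Finset.mul_sum, ← Finset.sum_add_distrib]
    exact Finset.sum_congr rfl fun i _ => Finset.sum_congr rfl fun j _ => by ring
  rw [dotProduct_mulVec_eq_sum, dotProduct_diagonal_mulVec, abs_le]
  constructor <;> linarith

theorem posSemidef_diagonal_sub [DecidableEq n] (hA : A.IsSymm) (hA0 : ∀ i j, 0 ≤ A i j)
    (hd : ∀ i, d i = ∑ j, A i j) : (diagonal d - A).PosSemidef := by
  refine .of_dotProduct_mulVec_nonneg ?_ fun x => ?_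
  · exact (isHermitian_diagonal d).sub ((conjTranspose_eq_transpose_of_trivial A).trans hA)
  · rw [star_trivial, sub_mulVec, dotProduct_sub]
    linarith [le_of_abs_le (abs_dotProduct_mulVec_le hA hA0 hd x)]

end WeightedGraph

/-- For a connected weighted Laplacian `ℒ` with positive degrees, the regularized Laplacian
`ℒ + (d_min/N)𝟏𝟏ᵀ` is positive definite and its inverse dominates `(1/3)𝒟⁻¹`. -/
theorem regularized_laplacian_inverse_bound {N : ℕ}
    (𝒜 : Matrix (Fin N) (Fin N) ℝ)
    (h𝒜symm : 𝒜.IsSymm) (h𝒜nonneg : ∀ i j, 0 ≤ 𝒜 i j) (h𝒜diag : ∀ i, 𝒜 i i = 0)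
    (d : Fin N → ℝ) (hd : ∀ i, d i = ∑ j, 𝒜 i j) (hdpos : ∀ i, 0 < d i)
    (ℒ : Matrix (Fin N) (Fin N) ℝ) (hℒ : ℒ = Matrix.diagonal d - 𝒜)
    (hconn : ∀ v : Fin N → ℝ, ℒ *ᵥ v = 0 → ∃ c : ℝ, v = fun _ => c)
    (dmin : ℝ) (hdmin : IsLeast (Set.range d) dmin)
    (J : Matrix (Fin N) (Fin N) ℝ) (hJ : ∀ i j, J i j = 1) :
    (ℒ + (dmin / (N : ℝ)) • J).PosDef ∧
    ((ℒ + (dmin / (N : ℝ)) • J)⁻¹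
      - (1 / 3 : ℝ) • (Matrix.diagonal d)⁻¹).PosSemidef := by
  have hN : (0 : ℝ) < N := by
    obtain ⟨i, -⟩ := hdmin.1
    exact_mod_cast i.pos
  have hdm : 0 < dmin := by
    obtain ⟨i, hi⟩ := hdmin.1
    exact hi ▸ hdpos i
  have hL : ℒ.PosSemidef := hℒ ▸ posSemidef_diagonal_sub h𝒜symm h𝒜nonneg hd
  have hJx (x : Fin N → ℝ) : x ⬝ᵥ (((dmin / (N : ℝ)) • J) *ᵥ x)
      = dmin / N * (∑ i, x i) ^ 2 := by
    rw [smul_mulVec, dotProduct_smul, smul_eq_mul]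
    simp [dotProduct, mulVec, hJ, sq, Finset.sum_mul]
  have hsJ : ((dmin / (N : ℝ)) • J).IsHermitian := by
    ext i j
    simp [hJ]
  have hpos : (ℒ + (dmin / (N : ℝ)) • J).PosDef := by
    refine .of_dotProduct_mulVec_pos (hL.isHermitian.add hsJ) fun x hx => ?_
    have h1 := hL.dotProduct_mulVec_nonneg x
    have h2 : 0 ≤ dmin / N * (∑ i, x i) ^ 2 := by positivity
    rw [add_mulVec, dotProduct_add]
    rw [star_trivial] at h1 ⊢
    rw [hJx]
    refine lt_of_le_of_ne (by positivity) fun h0 => hx ?_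
    obtain ⟨c, rfl⟩ := hconn x ((hL.dotProduct_mulVec_zero_iff x).1 (by
      rw [star_trivial]; linarith))
    have h3 : dmin / N * (∑ _i : Fin N, c) ^ 2 = 0 := by linarith
    have h4 : c = 0 := by simpa [hdm.ne', hN.ne'] using h3
    ext
    simp [h4]
  refine ⟨hpos, ?_⟩
  have hD : (diagonal d).PosDef := PosDef.diagonal hdpos
  have hE : ((3 : ℝ) • diagonal d).PosDef := hD.smul (by norm_num)
  have hEinv : ((3 : ℝ) • diagonal d)⁻¹ = (1 / 3 : ℝ) • (diagonal d)⁻¹ := by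
    rw [Matrix.inv_smul (diagonal d) (3 : ℝ) ((Matrix.isUnit_iff_isUnit_det _).1 hD.isUnit)]
    simp
  rw [← hEinv]
  refine posSemidef_inv_sub_inv hpos hE
    (.of_dotProduct_mulVec_nonneg (hE.isHermitian.sub hpos.isHermitian) fun x => ?_)
  have h1 := neg_le_of_abs_le (abs_dotProduct_mulVec_le h𝒜symm h𝒜nonneg hd x)
  have h2 : dmin / N * (∑ i, x i) ^ 2 ≤ x ⬝ᵥ (diagonal d *ᵥ x) := calc
    dmin / N * (∑ i, x i) ^ 2 ≤ dmin / N * (N * ∑ i, x i ^ 2) := by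
      gcongr
      simpa using sq_sum_le_card_mul_sum_sq (s := Finset.univ) (f := x)
    _ = ∑ i, dmin * x i ^ 2 := by
      rw [← Finset.mul_sum]
      field_simp
    _ ≤ ∑ i, d i * x i ^ 2 := by
      gcongr with i
      exact hdmin.2 ⟨i, rfl⟩
    _ = _ := (dotProduct_diagonal_mulVec d x).symm
  rw [star_trivial, sub_mulVec, add_mulVec, dotProduct_sub, dotProduct_add, hJx, hℒ, sub_mulVec,
    dotProduct_sub, smul_mulVec, dotProduct_smul, smul_eq_mul]
  linarith
end
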